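/- Let f : B → A and α : A → I be functions between types, let x : J → I be any function, and let (i ↦ M^I(i)) be the terminal P^I-coalgebra described by: M^I(i) is the largest subset of a terminal P_f-coalgebra M_f such that every T ∈ M^I(i) satisfies τ_f(T) = (a, t) with α(a) = i and t(b) ∈ M^I(i) for all b. Define the reindexed polynomial functor P^J on J-indexed families Y : J → Type by P^J(Y)(j) = Σ (a : {a : A // α a = x j}), (f⁻¹(a) → Y(j)) (this is the indexed polynomial functor of the pullback of f along x). Then the J-indexed family j ↦ M^I(x j), with the structure maps obtained from those of M^I, is a terminal P^J-coalgebra. In particular, reindexing along x preserves M-types. -/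

import Mathlib

open CategoryTheory

section

variable {B A I J : Type} (f : B → A) (α : A → I) (x : J → I)

/-- A coalgebra for the indexed polynomial functor `P^I` determined by `f : B → A` and
`α : A → I`: a family `X : I → Type` with maps
`γ i : X i → Σ (a : {a // α a = i}), (f⁻¹(a) → X i)`. -/
structure ICoalg (f : B → A) (α : A → I) where
  X : I → Type
  str : ∀ i : I, X i → Σ a : {a : A // α a = i}, ({b : B // f b = a.1} → X i)

/-- A morphism of `P^I`-coalgebras. -/
@[ext]
structure ICoalg.Hom (P Q : ICoalg f α) where
  φ : ∀ i, P.X i → Q.X i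
  comm : ∀ i x, Q.str i (φ i x) = ⟨(P.str i x).1, fun b => φ i ((P.str i x).2 b)⟩

instance : Category (ICoalg f α) where
  Hom P Q := ICoalg.Hom f α P Q
  id P := ⟨fun _ => id, fun i x => rfl⟩
  comp {P Q R} g h :=
    ⟨fun i => h.φ i ∘ g.φ i, fun i x => by
      show R.str i (h.φ i (g.φ i x)) = _
      rw [h.comm i (g.φ i x), g.comm i x]
      rfl⟩
  id_comp g := ICoalg.Hom.ext rfl
  comp_id g := ICoalg.Hom.ext rfl
  assoc g h i := ICoalg.Hom.ext rfl

/-- A coalgebra for the reindexed polynomial functor `P^J`, acting on `J`-indexed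
families by `P^J(Y)(j) = Σ (a : {a // α a = x j}), (f⁻¹(a) → Y j)` (the indexed
polynomial functor of the pullback of `f` along `x`). -/
structure JCoalg (f : B → A) (α : A → I) (x : J → I) where
  X : J → Type
  str : ∀ j : J, X j → Σ a : {a : A // α a = x j}, ({b : B // f b = a.1} → X j)

/-- A morphism of `P^J`-coalgebras. -/
@[ext]
structure JCoalg.Hom (P Q : JCoalg f α x) where
  φ : ∀ j, P.X j → Q.X j
  comm : ∀ j y, Q.str j (φ j y) = ⟨(P.str j y).1, fun b => φ j ((P.str j y).2 b)⟩

instance : Category (JCoalg f α x) where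
  Hom P Q := JCoalg.Hom f α x P Q
  id P := ⟨fun _ => id, fun j y => rfl⟩
  comp {P Q R} g h :=
    ⟨fun j => h.φ j ∘ g.φ j, fun j y => by
      show R.str j (h.φ j (g.φ j y)) = _
      rw [h.comm j (g.φ j y), g.comm j y]
      rfl⟩
  id_comp g := JCoalg.Hom.ext rfl
  comp_id g := JCoalg.Hom.ext rfl
  assoc g h i := JCoalg.Hom.ext rfl

/-- The polynomial functor of `f` as a `PFunctor`, whose `M`-type is Mathlib's
`PFunctor.M`, a terminal `P_f`-coalgebra. -/
def PolyPF : PFunctor := ⟨A, fun a => {b : B // f b = a}⟩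

/-- `C ⊆ M_f` is closed under the slice condition at `i : I` if every `T ∈ C` has root
labelled by some `a` with `α a = i` and all children again in `C`. -/
def HeredI (i : I) (C : Set (PolyPF f).M) : Prop :=
  ∀ T ∈ C, α (PFunctor.M.dest T).1 = i ∧ ∀ b, (PFunctor.M.dest T).2 b ∈ C

/-- `M^I i`, the largest subset of `M_f` all of whose members have all labels in the
fibre of `α` over `i`. -/
def MI (i : I) : Set (PolyPF f).M :=
  {T | ∃ C : Set (PolyPF f).M, HeredI f α i C ∧ T ∈ C}

/-- The left adjoint of reindexing, on objects. -/
def JCoalg.push (Y : JCoalg f α x) : ICoalg f α where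
  X i := Σ j : {j : J // x j = i}, Y.X j.1
  str := fun i p => match i, p with
    | _, ⟨⟨j, rfl⟩, y⟩ => ⟨(Y.str j y).1, fun b => ⟨⟨j, rfl⟩, (Y.str j y).2 b⟩⟩

/-- Reindexing of a coalgebra along `x`. -/
def ICoalg.pull (M : ICoalg f α) : JCoalg f α x := ⟨fun j => M.X (x j), fun j => M.str (x j)⟩

/-- Transpose from pushed to pulled. -/
def ICoalg.down (Y : JCoalg f α x) (M : ICoalg f α) (g : ICoalg.Hom f α (Y.push f α x) M) :
    JCoalg.Hom f α x Y (M.pull f α x) where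
  φ j y := g.φ (x j) ⟨⟨j, rfl⟩, y⟩
  comm j y := g.comm (x j) ⟨⟨j, rfl⟩, y⟩

/-- Transpose from pulled to pushed. -/
def ICoalg.up (Y : JCoalg f α x) (M : ICoalg f α) (g : JCoalg.Hom f α x Y (M.pull f α x)) :
    ICoalg.Hom f α (Y.push f α x) M where
  φ := fun i p => match i, p with
    | _, ⟨⟨j, rfl⟩, y⟩ => g.φ j y
  comm := by
    rintro _ ⟨⟨j, rfl⟩, y⟩
    exact g.comm j y

theorem ICoalg.pull_terminal (M : ICoalg f α) (h : Limits.IsTerminal M) :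
    Nonempty (Limits.IsTerminal (M.pull f α x)) := by
  refine ⟨Limits.IsTerminal.ofUniqueHom
    (fun Y => ICoalg.down f α x Y M (h.from (Y.push f α x))) ?_⟩
  intro Y g
  have e : ICoalg.up f α x Y M g = h.from (Y.push f α x) := h.hom_ext (Y := Y.push f α x) _ _
  rw [← e]
  rfl

/-- Reindexing along `x : J → I` preserves M-types: if `(i ↦ M^I i, γI)` is the terminal
`P^I`-coalgebra, with `M^I i` the largest hereditarily `i`-labelled subset of `M_f` and
`γI` induced by `τ_f` (i.e. by `PFunctor.M.dest`), then the `J`-indexed family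
`j ↦ M^I (x j)`, with structure maps obtained from those of `M^I`, is a terminal
`P^J`-coalgebra. -/
theorem reindexed_MI_is_terminal
    (γI : ∀ i : I, ↥(MI f α i) →
      Σ a : {a : A // α a = i}, ({b : B // f b = a.1} → ↥(MI f α i)))
    (hdesc : ∀ (i : I) (T : ↥(MI f α i)),
      ∃ h : ((γI i T).1.1 : A) = (PFunctor.M.dest T.1).1,
        ∀ (b : B) (hb : f b = (PFunctor.M.dest T.1).1),
          ((γI i T).2 ⟨b, hb.trans h.symm⟩).1 = (PFunctor.M.dest T.1).2 ⟨b, hb⟩)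
    (hterm : Nonempty (Limits.IsTerminal
      (⟨fun i => ↥(MI f α i), γI⟩ : ICoalg f α))) :
    Nonempty (Limits.IsTerminal
      (⟨fun j => ↥(MI f α (x j)), fun j => γI (x j)⟩ : JCoalg f α x)) := by
  exact hterm.elim fun h => ICoalg.pull_terminal f α x _ h

end
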